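/- arXiv:2408.05848 — 2 statements merged into one kernel-verified Lean document; each statement's English description precedes it below -/
import Mathlib

section
/- In the Berwald frame setting, if S I = 0 (the Landsberg condition) and S K = 0 (the flag curvature is S-invariant), then H K = 0 on N. -/
/-- Derivative `X f` of a function `f` along a vector field `X`:
`(X f)(p) = df_p(X(p))`. -/
noncomputable def dAlong {E : Type*} [NormedAddCommGroup E] [NormedSpace ℝ E]
    (X : E → E) (f : E → ℝ) : E → ℝ :=
  fun p => fderiv ℝ f p (X p)

/-- Lie bracket `[X,Y]` of two vector fields. -/
noncomputable def lieB {E : Type*} [NormedAddCommGroup E] [NormedSpace ℝ E]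
    (X Y : E → E) : E → E :=
  fun p => fderiv ℝ Y p (X p) - fderiv ℝ X p (Y p)

/-- The derivative along a vector field only depends on the germ of the function. -/
theorem dAlong_congr {E : Type*} [NormedAddCommGroup E] [NormedSpace ℝ E]
    {X : E → E} {f g : E → ℝ} {p : E} (h : f =ᶠ[nhds p] g) :
    dAlong X f p = dAlong X g p := by
  simp only [dAlong, h.fderiv_eq]

theorem dAlong_zero {E : Type*} [NormedAddCommGroup E] [NormedSpace ℝ E]
    (X : E → E) (p : E) : dAlong X (fun _ => (0 : ℝ)) p = 0 := by
  simp [dAlong]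

/-- Second derivative along vector fields, in terms of the second Fréchet derivative. -/
theorem dAlong_dAlong {E : Type*} [NormedAddCommGroup E] [NormedSpace ℝ E]
    {X Y : E → E} {f : E → ℝ} {p : E}
    (hf : ContDiffAt ℝ 2 f p) (hY : DifferentiableAt ℝ Y p) :
    dAlong X (dAlong Y f) p =
      fderiv ℝ (fderiv ℝ f) p (X p) (Y p) + fderiv ℝ f p (fderiv ℝ Y p (X p)) := by
  have hd : DifferentiableAt ℝ (fderiv ℝ f) p :=
    (hf.fderiv_right (m := 1) (by norm_num)).differentiableAt (by norm_num)
  unfold dAlong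
  rw [fderiv_clm_apply hd hY]
  simp [add_comm]

/-- The Lie bracket acts on functions as the commutator of derivations. -/
theorem dAlong_lieB {E : Type*} [NormedAddCommGroup E] [NormedSpace ℝ E]
    {X Y : E → E} {f : E → ℝ} {p : E} (hf : ContDiffAt ℝ 2 f p)
    (hX : DifferentiableAt ℝ X p) (hY : DifferentiableAt ℝ Y p) :
    dAlong (lieB X Y) f p = dAlong X (dAlong Y f) p - dAlong Y (dAlong X f) p := by
  have hsymm : IsSymmSndFDerivAt ℝ f p := hf.isSymmSndFDerivAt (by simp)
  rw [dAlong_dAlong hf hY, dAlong_dAlong hf hX, hsymm.eq (X p) (Y p)]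
  simp [dAlong, lieB]

/-- In the Berwald frame setting, if `S I = 0` (Landsberg)
and `S K = 0` (the flag curvature is `S`-invariant), then `H K = 0` on `N`. -/
theorem statement10
    {E : Type*} [NormedAddCommGroup E] [NormedSpace ℝ E]
    (N : Set E) (hNopen : IsOpen N)
    (S H V C : E → E) (K I : E → ℝ)
    (hS : ContDiffOn ℝ (⊤ : ℕ∞) S N) (hH : ContDiffOn ℝ (⊤ : ℕ∞) H N)
    (hV : ContDiffOn ℝ (⊤ : ℕ∞) V N) (hC : ContDiffOn ℝ (⊤ : ℕ∞) C N)
    (hK : ContDiffOn ℝ (⊤ : ℕ∞) K N) (hI : ContDiffOn ℝ (⊤ : ℕ∞) I N)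
    (hSH : ∀ p ∈ N, lieB S H p = K p • V p)
    (hSV : ∀ p ∈ N, lieB S V p = -(H p))
    (hHV : ∀ p ∈ N, lieB H V p = S p + I p • H p + dAlong S I p • V p)
    (hBianchi : ∀ p ∈ N, dAlong S (dAlong S I) p + dAlong V K p + I p * K p = 0)
    (hLand : ∀ p ∈ N, dAlong S I p = 0)
    (hSK : ∀ p ∈ N, dAlong S K p = 0) :
    ∀ p ∈ N, dAlong H K p = 0 := by
  intro p hp
  have hN : N ∈ nhds p := hNopen.mem_nhds hp
  have hKp : ContDiffAt ℝ 2 K p := (hK.contDiffAt hN).of_le (WithTop.coe_le_coe.2 (le_top : (2 : ℕ∞) ≤ ⊤))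
  have hSp : DifferentiableAt ℝ S p := (hS.contDiffAt hN).differentiableAt (by simp)
  have hVp : DifferentiableAt ℝ V p := (hV.contDiffAt hN).differentiableAt (by simp)
  have hIp : DifferentiableAt ℝ I p := (hI.contDiffAt hN).differentiableAt (by simp)
  have hSSI : ∀ q ∈ N, dAlong S (dAlong S I) q = 0 := fun q hq =>
    (dAlong_congr (Filter.eventually_of_mem (hNopen.mem_nhds hq) hLand)).trans (dAlong_zero S q)
  have hVSK : dAlong V (dAlong S K) p = 0 :=
    (dAlong_congr (Filter.eventually_of_mem hN hSK)).trans (dAlong_zero V p)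
  have hVK : ∀ q ∈ N, dAlong V K q = -(I q * K q) := fun q hq => by
    linarith [hBianchi q hq, hSSI q hq]
  have hSVK : dAlong S (dAlong V K) p = 0 := by
    rw [dAlong_congr (Filter.eventually_of_mem hN hVK)]
    have hSI := hLand p hp
    have hSK' := hSK p hp
    simp only [dAlong] at hSI hSK' ⊢
    rw [fderiv_fun_neg, fderiv_fun_mul hIp (hKp.differentiableAt (by norm_num))]
    simp [hSI, hSK']
  have hcomm := dAlong_lieB hKp hSp hVp
  rw [hSVK, hVSK] at hcomm
  simpa [dAlong, hSV p hp] using hcomm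
end

section
/- In the Berwald frame setting, if S I = 0 (the Landsberg condition), S K = 0 (the flag curvature is S-invariant), and K is nowhere zero on N, then H I = 0 on N; i.e., the surface is Berwaldian. -/
/-- A map that is smooth on an open set is differentiable at each of its points. -/
theorem differentiableAt_of_contDiffOn_isOpen {E F : Type*} [NormedAddCommGroup E]
    [NormedSpace ℝ E] [NormedAddCommGroup F] [NormedSpace ℝ F] {N : Set E} (hN : IsOpen N)
    {g : E → F} (hg : ContDiffOn ℝ (⊤ : ℕ∞) g N) {p : E} (hp : p ∈ N) :
    DifferentiableAt ℝ g p :=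
  (hg.contDiffAt (hN.mem_nhds hp)).differentiableAt (by simp)

/-- A function vanishing on an open set has vanishing derivative there along any vector field. -/
theorem dAlong_eq_zero_of_eqOn_zero {E : Type*} [NormedAddCommGroup E] [NormedSpace ℝ E]
    {N : Set E} (hN : IsOpen N) (X : E → E) {f : E → ℝ} (hf : ∀ p ∈ N, f p = 0)
    {p : E} (hp : p ∈ N) : dAlong X f p = 0 := by
  have h : f =ᶠ[nhds p] fun _ => (0 : ℝ) := by
    filter_upwards [hN.mem_nhds hp] with q hq using hf q hq
  simp [dAlong, h.fderiv_eq]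

/-- The Lie bracket acts on functions as the commutator of derivations. -/
theorem fderiv_lieB {E : Type*} [NormedAddCommGroup E] [NormedSpace ℝ E]
    {X Y : E → E} {f : E → ℝ} {p : E} (hX : DifferentiableAt ℝ X p)
    (hY : DifferentiableAt ℝ Y p) (hf : ContDiffAt ℝ 2 f p) :
    fderiv ℝ f p (lieB X Y p) = dAlong X (dAlong Y f) p - dAlong Y (dAlong X f) p := by
  have hdf : DifferentiableAt ℝ (fderiv ℝ f) p :=
    (hf.fderiv_right (m := 1) (by norm_num)).differentiableAt (by norm_num)
  have hsymm := (hf.isSymmSndFDerivAt (by simp)).eq (X p) (Y p)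
  have key : ∀ {Z : E → E}, DifferentiableAt ℝ Z p → ∀ v : E,
      fderiv ℝ (dAlong Z f) p v
        = fderiv ℝ (fderiv ℝ f) p v (Z p) + fderiv ℝ f p (fderiv ℝ Z p v) := by
    intro Z hZ v
    have h := (hdf.hasFDerivAt.clm_apply hZ.hasFDerivAt).fderiv
    change fderiv ℝ (fun q => fderiv ℝ f q (Z q)) p v = _
    rw [h]
    simp [add_comm]
  rw [dAlong, dAlong, key hY, key hX, hsymm, lieB, map_sub]
  ring

/-- In the Berwald frame setting, if `S I = 0` (Landsberg),
`S K = 0` (the flag curvature is `S`-invariant), and `K` is nowhere zero on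
`N`, then `H I = 0` on `N`; i.e. the surface is Berwaldian. -/
theorem statement11
    {E : Type*} [NormedAddCommGroup E] [NormedSpace ℝ E]
    (N : Set E) (hNopen : IsOpen N)
    (S H V C : E → E) (K I : E → ℝ)
    (hS : ContDiffOn ℝ (⊤ : ℕ∞) S N) (hH : ContDiffOn ℝ (⊤ : ℕ∞) H N)
    (hV : ContDiffOn ℝ (⊤ : ℕ∞) V N) (hC : ContDiffOn ℝ (⊤ : ℕ∞) C N)
    (hK : ContDiffOn ℝ (⊤ : ℕ∞) K N) (hI : ContDiffOn ℝ (⊤ : ℕ∞) I N)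
    (hSH : ∀ p ∈ N, lieB S H p = K p • V p)
    (hSV : ∀ p ∈ N, lieB S V p = -(H p))
    (hHV : ∀ p ∈ N, lieB H V p = S p + I p • H p + dAlong S I p • V p)
    (hBianchi : ∀ p ∈ N, dAlong S (dAlong S I) p + dAlong V K p + I p * K p = 0)
    (hLand : ∀ p ∈ N, dAlong S I p = 0)
    (hSK : ∀ p ∈ N, dAlong S K p = 0)
    (hKne : ∀ p ∈ N, K p ≠ 0) :
    ∀ p ∈ N, dAlong H I p = 0 := by
  have hK2 : ∀ p ∈ N, ContDiffAt ℝ 2 K p := fun p hp =>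
    contDiffAt_infty.mp (hK.contDiffAt (hNopen.mem_nhds hp)) 2
  have hSVK : ∀ p ∈ N, dAlong S (dAlong V K) p = 0 := by
    intro p hp
    have heq : dAlong V K =ᶠ[nhds p] fun q => -(I q * K q) := by
      filter_upwards [hNopen.mem_nhds hp] with q hq
      have h1 := hBianchi q hq
      rw [dAlong_eq_zero_of_eqOn_zero hNopen S hLand hq] at h1
      linarith
    have hSI := hLand p hp
    have hSK' := hSK p hp
    have hmul := ((differentiableAt_of_contDiffOn_isOpen hNopen hI hp).hasFDerivAt.mul
      (differentiableAt_of_contDiffOn_isOpen hNopen hK hp).hasFDerivAt).neg.fderiv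
    simp only [dAlong] at hSI hSK'
    change fderiv ℝ (dAlong V K) p (S p) = 0
    rw [heq.fderiv_eq]
    refine (congrArg (fun L => L (S p)) hmul).trans ?_
    simp [hSI, hSK']
  have hHK : ∀ p ∈ N, dAlong H K p = 0 := by
    intro p hp
    have h := fderiv_lieB
      (differentiableAt_of_contDiffOn_isOpen hNopen hS hp)
      (differentiableAt_of_contDiffOn_isOpen hNopen hV hp) (hK2 p hp)
    rw [hSV p hp, hSVK p hp, dAlong_eq_zero_of_eqOn_zero hNopen V hSK hp, map_neg] at h
    simpa [dAlong] using h
  have hI0 : ∀ p ∈ N, I p = 0 := by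
    intro p hp
    have h := fderiv_lieB
      (differentiableAt_of_contDiffOn_isOpen hNopen hS hp)
      (differentiableAt_of_contDiffOn_isOpen hNopen hH hp) (hK2 p hp)
    rw [hSH p hp, dAlong_eq_zero_of_eqOn_zero hNopen S hHK hp,
      dAlong_eq_zero_of_eqOn_zero hNopen H hSK hp, map_smul, smul_eq_mul, sub_zero] at h
    have hVK : dAlong V K p = 0 := (mul_eq_zero.mp h).resolve_left (hKne p hp)
    have hB := hBianchi p hp
    rw [dAlong_eq_zero_of_eqOn_zero hNopen S hLand hp, hVK, zero_add, zero_add] at hB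
    exact (mul_eq_zero.mp hB).resolve_right (hKne p hp)
  exact fun p hp => dAlong_eq_zero_of_eqOn_zero hNopen H hI0 hp
end
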